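/- arXiv:1411.7153 — 3 statements merged into one kernel-verified Lean document; each statement's English description precedes it below -/
import Mathlib

section
/- Let J₁ be the order-one Bessel function of the first kind (regular at 0), K₁ the order-one modified Bessel function of the second kind (exponentially decaying at infinity), 0<j₁<j₂<… the positive zeros of J₁ and 0<j₁'<j₂'<… the positive zeros of J₁'. Set η_* = √(j₁² - j₁'²) and η* = √((j₂')² - j₁²). Then η_* < η*, and for every η ∈ [η_*, η*] there exists a unique ξ = ξ(η) ∈ (j₁', j₁) such that J₁(ξ)/(ξJ₁'(ξ)) = K₁(η)/(ηK₁'(η)) and j₁² < ξ² + η² < (j₂')². -/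
open MeasureTheory Filter Matrix
open scoped Classical

noncomputable section

set_option linter.unusedVariables false


/-- Partial sums of the power series of the Bessel function `J₀`. -/
def besselZeroSum (n : ℕ) (x : ℝ) : ℝ :=
  ∑ k ∈ Finset.range (n + 1), (-1) ^ k * (x / 2) ^ (2 * k) / ((k.factorial : ℝ) ^ 2)

/-- Partial sums of the power series of the Bessel function `J₁`. -/
def besselOneSum (n : ℕ) (x : ℝ) : ℝ :=
  ∑ k ∈ Finset.range (n + 1),
    (-1) ^ k * (x / 2) ^ (2 * k + 1) / ((k.factorial : ℝ) * ((k + 1).factorial : ℝ))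

theorem besselZeroSum_zero_right (n : ℕ) : besselZeroSum n 0 = 1 := by
  simp [besselZeroSum, Finset.sum_range_succ']

theorem hasDerivAt_besselZeroSum (n : ℕ) (x : ℝ) :
    HasDerivAt (besselZeroSum (n + 1)) (-besselOneSum n x) x := by
  have h : HasDerivAt (besselZeroSum (n + 1))
      (∑ k ∈ Finset.range (n + 2), (-1) ^ k *
        (((2 * k : ℕ) : ℝ) * (x / 2) ^ (2 * k - 1) * (1 / 2)) / ((k.factorial : ℝ) ^ 2)) x := by
    unfold besselZeroSum
    refine HasDerivAt.fun_sum fun k _ => ?_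
    exact ((((hasDerivAt_id x).div_const 2).pow (2 * k)).const_mul _).div_const _
  convert h using 1
  rw [Finset.sum_range_succ', besselOneSum, ← Finset.sum_neg_distrib]
  simp only [Nat.cast_zero, zero_mul, mul_zero, zero_div, add_zero]
  refine Finset.sum_congr rfl fun k _ => ?_
  have e : 2 * (k + 1) - 1 = 2 * k + 1 := by omega
  have hk : (k.factorial : ℝ) ≠ 0 := by positivity
  have hk' : (k : ℝ) + 1 ≠ 0 := by positivity
  rw [e, Nat.factorial_succ]
  push_cast
  field_simp
  ring

theorem hasDerivAt_mul_besselOneSum (n : ℕ) (x : ℝ) :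
    HasDerivAt (fun y => y * besselOneSum n y) (x * besselZeroSum n x) x := by
  have h : HasDerivAt (fun y => y * besselOneSum n y)
      (∑ k ∈ Finset.range (n + 1), (1 * ((-1) ^ k * (x / 2) ^ (2 * k + 1) /
          ((k.factorial : ℝ) * ((k + 1).factorial : ℝ))) + x * ((-1) ^ k *
        (((2 * k + 1 : ℕ) : ℝ) * (x / 2) ^ (2 * k + 1 - 1) * (1 / 2)) /
          ((k.factorial : ℝ) * ((k + 1).factorial : ℝ))))) x := by
    unfold besselOneSum
    simp only [Finset.mul_sum]
    refine HasDerivAt.fun_sum fun k _ => ?_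
    exact (hasDerivAt_id x).mul
      (((((hasDerivAt_id x).div_const 2).pow (2 * k + 1)).const_mul _).div_const _)
  convert h using 1
  rw [besselZeroSum, Finset.mul_sum]
  refine Finset.sum_congr rfl fun k _ => ?_
  have hk : (k.factorial : ℝ) ≠ 0 := by positivity
  have hk' : (k : ℝ) + 1 ≠ 0 := by positivity
  rw [Nat.factorial_succ, Nat.add_sub_cancel]
  push_cast
  field_simp
  ring

theorem nonneg_of_hasDerivAt_nonneg {f f' : ℝ → ℝ} (hc : ContinuousOn f (Set.Ici 0))
    (hd : ∀ x > 0, HasDerivAt f (f' x) x) (hf' : ∀ x > 0, 0 ≤ f' x) (h0 : f 0 = 0)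
    {x : ℝ} (hx : 0 ≤ x) : 0 ≤ f x := by
  have hm : MonotoneOn f (Set.Ici 0) := by
    refine monotoneOn_of_deriv_nonneg (convex_Ici 0) hc ?_ ?_
    · intro y hy
      rw [interior_Ici] at hy
      exact (hd y hy).differentiableAt.differentiableWithinAt
    · intro y hy
      rw [interior_Ici] at hy
      rw [(hd y hy).deriv]
      exact hf' y hy
  simpa [h0] using hm (Set.mem_Ici.2 le_rfl) (Set.mem_Ici.2 hx) hx

/-- The partial sums of the series of `J₀` and `J₁` alternately bound a solution `(A, J)` of the
first order system satisfied by `(J₀, J₁)`. -/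
theorem bessel_alternating_bounds {A J : ℝ → ℝ} (hAc : Continuous A) (hJc : Continuous J)
    (hA : ∀ x > 0, HasDerivAt A (-J x) x)
    (hJ : ∀ x > 0, HasDerivAt (fun y => y * J y) (x * A x) x)
    (hA0 : A 0 = 1) (hJ0 : J 0 = 0) (n : ℕ) :
    ∀ x ≥ 0, 0 ≤ (-1) ^ n * (besselZeroSum n x - A x) ∧
      (0 < x → 0 ≤ (-1) ^ n * (besselOneSum n x - J x)) := by
  have step : ∀ n : ℕ, (∀ x ≥ 0, 0 ≤ (-1) ^ n * (besselZeroSum n x - A x)) →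
      ∀ x > 0, 0 ≤ (-1) ^ n * (besselOneSum n x - J x) := by
    intro n h x hx
    have hd : ∀ y > 0, HasDerivAt (fun y => (-1) ^ n * (y * besselOneSum n y - y * J y))
        ((-1) ^ n * (y * besselZeroSum n y - y * A y)) y := fun y hy =>
      ((hasDerivAt_mul_besselOneSum n y).sub (hJ y hy)).const_mul _
    have hc : Continuous (fun y => y * besselOneSum n y) :=
      continuous_iff_continuousAt.2 fun y => (hasDerivAt_mul_besselOneSum n y).continuousAt
    have key := nonneg_of_hasDerivAt_nonneg
      (f := fun y => (-1) ^ n * (y * besselOneSum n y - y * J y)) (by fun_prop) hd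
      (fun y hy => by
        have := mul_nonneg hy.le (h y hy.le)
        linarith) (by simp) hx.le
    refine nonneg_of_mul_nonneg_right (a := x) ?_ hx
    linarith
  suffices h : ∀ x ≥ 0, 0 ≤ (-1) ^ n * (besselZeroSum n x - A x) from
    fun x hx => ⟨h x hx, step n h x⟩
  induction n with
  | zero =>
    intro x hx
    have hJ' : ∀ y > 0, HasDerivAt J (A y - J y / y) y := by
      intro y hy
      have h := (hJ y hy).div (hasDerivAt_id y) hy.ne'
      refine (h.congr_of_eventuallyEq ?_).congr_deriv ?_
      · filter_upwards [lt_mem_nhds hy] with z hz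
        have : z ≠ 0 := ne_of_gt hz
        simp [this]
      · have := ne_of_gt hy
        simp only [id]
        field_simp
    have hd : ∀ y > 0, HasDerivAt (fun y => 1 - (A y ^ 2 + J y ^ 2)) (2 * J y ^ 2 / y) y := by
      intro y hy
      have := ne_of_gt hy
      refine ((((hA y hy).pow 2).add ((hJ' y hy).pow 2)).const_sub 1).congr_deriv ?_
      field_simp
      ring
    have key := nonneg_of_hasDerivAt_nonneg (by fun_prop) hd (fun y hy => by positivity)
      (by simp [hA0, hJ0]) hx
    simp only [besselZeroSum, zero_add, Finset.range_one, Finset.sum_singleton]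
    simp
    nlinarith [sq_nonneg (J x), sq_nonneg (A x - 1)]
  | succ n ih =>
    intro x hx
    have hd : ∀ y > 0, HasDerivAt (fun y => (-1) ^ (n + 1) * (besselZeroSum (n + 1) y - A y))
        ((-1) ^ (n + 1) * (-besselOneSum n y - -J y)) y := fun y hy =>
      ((hasDerivAt_besselZeroSum n y).sub (hA y hy)).const_mul _
    have hc : Continuous (besselZeroSum (n + 1)) :=
      continuous_iff_continuousAt.2 fun y => (hasDerivAt_besselZeroSum n y).continuousAt
    exact nonneg_of_hasDerivAt_nonneg
      (f := fun y => (-1) ^ (n + 1) * (besselZeroSum (n + 1) y - A y)) (by fun_prop) hd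
      (fun y hy => by
        have := step n ih y hy
        rw [pow_succ]
        linarith) (by simp [besselZeroSum_zero_right, hA0]) hx

/-- Enclosures of `J₁` and of its derivative by partial sums of their power series. -/
theorem besselOne_bounds {J : ℝ → ℝ} (hJ : Differentiable ℝ J)
    (hJ' : Differentiable ℝ (deriv J))
    (ode : ∀ x : ℝ, x ^ 2 * deriv (deriv J) x + x * deriv J x + (x ^ 2 - 1) * J x = 0)
    (h0 : J 0 = 0) (hd0 : deriv J 0 = 1 / 2) {x : ℝ} (hx : 0 < x) (n : ℕ) :
    0 ≤ (-1) ^ n * (besselZeroSum n x - (deriv J x + J x / x)) ∧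
      0 ≤ (-1) ^ n * (besselOneSum n x - J x) := by
  have hAx : ∀ y > 0, deriv J y + dslope J 0 y = deriv J y + J y / y := by
    intro y hy
    rw [dslope_of_ne _ (ne_of_gt hy), slope_def_field, h0]
    simp
  have hAc : Continuous (fun y => deriv J y + dslope J 0 y) := by
    refine hJ'.continuous.add (continuous_iff_continuousAt.2 fun y => ?_)
    by_cases hy : y = 0
    · rw [hy]
      exact continuousAt_dslope_same.2 (hJ 0)
    · exact (continuousAt_dslope_of_ne hy).2 (hJ y).continuousAt
  have hA : ∀ y > 0, HasDerivAt (fun y => deriv J y + dslope J 0 y) (-J y) y := by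
    intro y hy
    have hy' := ne_of_gt hy
    have h := (hJ' y).hasDerivAt.add ((hJ y).hasDerivAt.div (hasDerivAt_id y) hy')
    refine (h.congr_of_eventuallyEq ?_).congr_deriv ?_
    · filter_upwards [lt_mem_nhds hy] with z hz
      exact hAx z hz
    · simp only [id]
      field_simp
      linarith [ode y]
  have hB : ∀ y > 0, HasDerivAt (fun y => y * J y)
      (y * (deriv J y + dslope J 0 y)) y := by
    intro y hy
    have hy' := ne_of_gt hy
    refine ((hasDerivAt_id y).mul (hJ y).hasDerivAt).congr_deriv ?_
    rw [hAx y hy]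
    simp only [id]
    field_simp
    ring
  have key := bessel_alternating_bounds hAc hJ.continuous hA hB
    (by rw [dslope_same, hd0]; norm_num) h0 n x hx.le
  rw [← hAx x hx]
  exact ⟨key.1, key.2 hx⟩

theorem besselOne_pos {J : ℝ → ℝ} (hJ : Differentiable ℝ J) (hJ' : Differentiable ℝ (deriv J))
    (ode : ∀ x : ℝ, x ^ 2 * deriv (deriv J) x + x * deriv J x + (x ^ 2 - 1) * J x = 0)
    (h0 : J 0 = 0) (hd0 : deriv J 0 = 1 / 2)
    {x : ℝ} (hx : 0 < x) (hx2 : x ≤ 2) : 0 < J x := by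
  have h := (besselOne_bounds hJ hJ' ode h0 hd0 hx 1).2
  norm_num [besselOneSum, Finset.sum_range_succ, Nat.factorial] at h
  nlinarith [mul_pos hx hx, mul_nonneg hx.le (sub_nonneg.2 hx2),
    mul_nonneg (mul_pos hx hx).le (sub_nonneg.2 hx2)]

theorem besselOne_neg {J : ℝ → ℝ} (hJ : Differentiable ℝ J) (hJ' : Differentiable ℝ (deriv J))
    (ode : ∀ x : ℝ, x ^ 2 * deriv (deriv J) x + x * deriv J x + (x ^ 2 - 1) * J x = 0)
    (h0 : J 0 = 0) (hd0 : deriv J 0 = 1 / 2)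
    {x : ℝ} (hx : 0 < x) (hx2 : x ^ 2 = 15) : J x < 0 := by
  have h := (besselOne_bounds hJ hJ' ode h0 hd0 hx 6).2
  have e : besselOneSum 6 x = x / 2 * ∑ k ∈ Finset.range 7,
      (-(x ^ 2) / 4) ^ k / ((k.factorial : ℝ) * ((k + 1).factorial : ℝ)) := by
    simp only [besselOneSum, Finset.sum_range_succ, Finset.sum_range_zero]
    ring
  rw [e, hx2] at h
  norm_num [Finset.sum_range_succ, Nat.factorial] at h
  linarith

theorem deriv_besselOne_pos {J : ℝ → ℝ} (hJ : Differentiable ℝ J) (hJ' : Differentiable ℝ (deriv J))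
    (ode : ∀ x : ℝ, x ^ 2 * deriv (deriv J) x + x * deriv J x + (x ^ 2 - 1) * J x = 0)
    (h0 : J 0 = 0) (hd0 : deriv J 0 = 1 / 2)
    {x : ℝ} (hx : 0 < x) (hx2 : x ^ 2 ≤ 3) : 0 < deriv J x := by
  have h₁ := (besselOne_bounds hJ hJ' ode h0 hd0 hx 3).1
  have h₂ := (besselOne_bounds hJ hJ' ode h0 hd0 hx 2).2
  have hd : J x / x ≤ besselOneSum 2 x / x := by
    gcongr
    linarith
  have e : besselZeroSum 3 x - besselOneSum 2 x / x =
      1 / 2 - 3 * (x ^ 2) / 16 + 5 * (x ^ 2) ^ 2 / 384 - (x ^ 2) ^ 3 / 2304 := by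
    norm_num [besselZeroSum, besselOneSum, Finset.sum_range_succ, Nat.factorial]
    field_simp
    ring
  have hp : 0 < 1 / 2 - 3 * (x ^ 2) / 16 + 5 * (x ^ 2) ^ 2 / 384 - (x ^ 2) ^ 3 / 2304 := by
    have ht := sq_nonneg x
    generalize x ^ 2 = t at *
    have b (i j : ℕ) : 0 ≤ t ^ i * (3 - t) ^ j :=
      mul_nonneg (pow_nonneg ht i) (pow_nonneg (sub_nonneg.2 hx2) j)
    linarith [b 0 3, b 1 2, b 2 1, b 3 0]
  linarith

theorem deriv_besselOne_neg {J : ℝ → ℝ} (hJ : Differentiable ℝ J) (hJ' : Differentiable ℝ (deriv J))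
    (ode : ∀ x : ℝ, x ^ 2 * deriv (deriv J) x + x * deriv J x + (x ^ 2 - 1) * J x = 0)
    (h0 : J 0 = 0) (hd0 : deriv J 0 = 1 / 2)
    {x : ℝ} (hx : 0 < x) (hx4 : 4 ≤ x ^ 2) (hx27 : x ^ 2 ≤ 27) :
    deriv J x < 0 := by
  have h₁ := (besselOne_bounds hJ hJ' ode h0 hd0 hx 6).1
  have h₂ := (besselOne_bounds hJ hJ' ode h0 hd0 hx 5).2
  have hd : besselOneSum 5 x / x ≤ J x / x := by
    gcongr
    linarith
  have e : besselZeroSum 6 x - besselOneSum 5 x / x =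
      (∑ k ∈ Finset.range 7, (-(x ^ 2) / 4) ^ k / (k.factorial : ℝ) ^ 2) -
        1 / 2 * ∑ k ∈ Finset.range 6,
          (-(x ^ 2) / 4) ^ k / ((k.factorial : ℝ) * ((k + 1).factorial : ℝ)) := by
    simp only [besselZeroSum, besselOneSum, Finset.sum_range_succ, Finset.sum_range_zero]
    field_simp
    ring
  have hp : (∑ k ∈ Finset.range 7, (-(x ^ 2) / 4) ^ k / (k.factorial : ℝ) ^ 2) -
        1 / 2 * ∑ k ∈ Finset.range 6,
          (-(x ^ 2) / 4) ^ k / ((k.factorial : ℝ) * ((k + 1).factorial : ℝ)) < 0 := by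
    have hu : 0 ≤ x ^ 2 - 4 := by linarith
    have hv : 0 ≤ 27 - x ^ 2 := by linarith
    generalize x ^ 2 = t at *
    have b (i j : ℕ) : 0 ≤ (t - 4) ^ i * (27 - t) ^ j :=
      mul_nonneg (pow_nonneg hu i) (pow_nonneg hv j)
    norm_num [Finset.sum_range_succ, Nat.factorial]
    linarith [b 0 6, b 1 5, b 2 4, b 3 3, b 4 2, b 5 1, b 6 0]
  linarith

/-- A solution of the modified Bessel equation of order one that vanishes at infinity has negative
logarithmic derivative. -/
theorem modifiedBessel_mul_deriv_neg {K : ℝ → ℝ}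
    (hK : ∀ x > 0, HasDerivAt K (deriv K x) x)
    (hK' : ∀ x > 0, HasDerivAt (deriv K) (deriv (deriv K) x) x)
    (ode : ∀ x > (0:ℝ), x ^ 2 * deriv (deriv K) x + x * deriv K x - (x ^ 2 + 1) * K x = 0)
    (decay : Tendsto K atTop (nhds 0)) (hpos : 0 < K 1) {a : ℝ} (ha : 0 < a) :
    K a * deriv K a < 0 := by
  by_contra! hneg
  have hE : ∀ x > 0, HasDerivAt (fun y => y * (K y * deriv K y))
      ((x ^ 2 + 1) / x * K x ^ 2 + x * deriv K x ^ 2) x := by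
    intro x hx
    have hx' := ne_of_gt hx
    refine ((hasDerivAt_id x).mul ((hK x hx).mul (hK' x hx))).congr_deriv ?_
    simp only [id, Pi.mul_apply]
    field_simp
    linear_combination K x * ode x hx
  have hEmono : MonotoneOn (fun y => y * (K y * deriv K y)) (Set.Ioi 0) := by
    refine monotoneOn_of_deriv_nonneg (convex_Ioi 0)
      (fun x hx => (hE x hx).continuousAt.continuousWithinAt) ?_ ?_
    · rw [interior_Ioi]
      exact fun x hx => (hE x hx).differentiableAt.differentiableWithinAt
    · rw [interior_Ioi]
      intro x hx
      rw [Set.mem_Ioi] at hx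
      rw [(hE x hx).deriv]
      positivity
  have hKK : ∀ x ≥ a, 0 ≤ K x * deriv K x := by
    intro x hx
    have hx0 : 0 < x := ha.trans_le hx
    have h := hEmono (Set.mem_Ioi.2 ha) (Set.mem_Ioi.2 hx0) hx
    exact nonneg_of_mul_nonneg_right ((mul_nonneg ha.le hneg).trans h) hx0
  have hsq : MonotoneOn (fun y => K y ^ 2) (Set.Ici a) := by
    have hd : ∀ x ≥ a, HasDerivAt (fun y => K y ^ 2) (2 * (K x * deriv K x)) x := by
      intro x hx
      refine ((hK x (ha.trans_le hx)).pow 2).congr_deriv ?_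
      ring
    refine monotoneOn_of_deriv_nonneg (convex_Ici a)
      (fun x hx => (hd x hx).continuousAt.continuousWithinAt) ?_ ?_
    · rw [interior_Ici]
      exact fun x hx => (hd x (le_of_lt hx)).differentiableAt.differentiableWithinAt
    · rw [interior_Ici]
      intro x hx
      rw [(hd x (le_of_lt hx)).deriv]
      linarith [hKK x (le_of_lt hx)]
  have hzero : ∀ x ≥ a, K x = 0 := by
    intro x hx
    have hlim : Tendsto (fun y => K y ^ 2) atTop (nhds 0) := by simpa using decay.pow 2
    have : K x ^ 2 ≤ 0 := by
      refine ge_of_tendsto hlim ?_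
      filter_upwards [eventually_ge_atTop x] with y hy
      exact hsq (Set.mem_Ici.2 hx) (Set.mem_Ici.2 (le_trans hx hy)) hy
    exact pow_eq_zero_iff two_ne_zero |>.1 (le_antisymm this (sq_nonneg _))
  have hone : 1 < a := by
    by_contra! h
    exact hpos.ne' (hzero 1 h)
  obtain ⟨c, hac⟩ := exists_gt a
  have hc0 : 0 < c := ha.trans hac
  have hKc : K c = 0 := hzero c hac.le
  have hdKc : deriv K c = 0 := by
    have : K =ᶠ[nhds c] fun _ => (0 : ℝ) := by
      filter_upwards [lt_mem_nhds hac] with y hy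
      exact hzero y hy.le
    rw [this.deriv_eq]
    simp
  have hW : ∀ x > 0, HasDerivAt (fun y => (K y ^ 2 + deriv K y ^ 2) * Real.exp (5 * y))
      (((2 * K x * deriv K x + 2 * deriv K x * deriv (deriv K) x) +
        5 * (K x ^ 2 + deriv K x ^ 2)) * Real.exp (5 * x)) x := by
    intro x hx
    have h5 : HasDerivAt (fun y : ℝ => Real.exp (5 * y)) (Real.exp (5 * x) * 5) x := by
      simpa using ((hasDerivAt_id x).const_mul (5 : ℝ)).exp
    refine ((((hK x hx).pow 2).add ((hK' x hx).pow 2)).mul h5).congr_deriv ?_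
    simp only [Pi.add_apply, Pi.pow_apply]
    ring
  have hWmono : MonotoneOn (fun y => (K y ^ 2 + deriv K y ^ 2) * Real.exp (5 * y))
      (Set.Ici 1) := by
    refine monotoneOn_of_deriv_nonneg (convex_Ici 1)
      (fun x hx => (hW x (one_pos.trans_le hx)).continuousAt.continuousWithinAt) ?_ ?_
    · rw [interior_Ici]
      exact fun x hx => (hW x (one_pos.trans hx)).differentiableAt.differentiableWithinAt
    · rw [interior_Ici]
      intro x hx
      rw [Set.mem_Ioi] at hx
      have hx0 : 0 < x := one_pos.trans hx
      rw [(hW x hx0).deriv]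
      refine mul_nonneg ?_ (Real.exp_pos _).le
      have hdd : deriv (deriv K) x = (1 + (1 / x) ^ 2) * K x - 1 / x * deriv K x := by
        field_simp
        linarith [ode x hx0]
      have hs0 : 0 < 1 / x := by positivity
      have hs1 : 1 / x < 1 := by
        rw [div_lt_one hx0]
        exact hx
      rw [hdd]
      generalize 1 / x = s at *
      have hs2 : s ^ 2 ≤ 1 := by nlinarith
      nlinarith [sq_nonneg (K x + deriv K x), mul_nonneg (sq_nonneg s) (sq_nonneg (K x + deriv K x)),
        mul_nonneg (sub_nonneg.2 hs1.le) (sq_nonneg (deriv K x)),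
        mul_nonneg (sub_nonneg.2 hs2) (sq_nonneg (deriv K x)),
        mul_nonneg (sub_nonneg.2 hs2) (sq_nonneg (K x)), sq_nonneg (K x), sq_nonneg (deriv K x)]
  have h := hWmono (Set.mem_Ici.2 le_rfl) (Set.mem_Ici.2 (hone.trans hac).le) (hone.trans hac).le
  simp only [hKc, hdKc] at h
  have : 0 < (K 1 ^ 2 + deriv K 1 ^ 2) * Real.exp (5 * 1) := by positivity
  norm_num at h
  norm_num at this
  linarith

/-- Lemma 4.7 / `bessel_zeugs` of the paper.  Let `J₁` be the
order-one Bessel function of the first kind (regular at `0`: smooth solution of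
`x²y'' + xy' + (x²-1)y = 0` with `J₁(0) = 0`, `J₁'(0) = 1/2`), and let `K₁` be the
order-one modified Bessel function of the second kind (positive solution of
`x²y'' + xy' - (x²+1)y = 0` on `(0,∞)` decaying at infinity).  Let `j₁ < j₂` be the
first two positive zeros of `J₁` and `j₁' < j₂'` the first two positive zeros of
`J₁'`, and set `η_* = √(j₁² - j₁'²)`, `η^* = √((j₂')² - j₁²)`.  Then `η_* < η^*`, and
for every `η ∈ [η_*, η^*]` there is a unique `ξ ∈ (j₁', j₁)` with
`J₁(ξ)/(ξ J₁'(ξ)) = K₁(η)/(η K₁'(η))` and `j₁² < ξ² + η² < (j₂')²`. -/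
theorem statement11 (J1 K1 : ℝ → ℝ)
    (hJ1smooth : ContDiff ℝ (⊤ : ℕ∞) J1)
    (hJ1ode : ∀ x : ℝ,
      x ^ 2 * deriv (deriv J1) x + x * deriv J1 x + (x ^ 2 - 1) * J1 x = 0)
    (hJ10 : J1 0 = 0) (hJ1d0 : deriv J1 0 = 1 / 2)
    (hK1smooth : ContDiffOn ℝ (⊤ : ℕ∞) K1 (Set.Ioi 0))
    (hK1ode : ∀ x > (0:ℝ),
      x ^ 2 * deriv (deriv K1) x + x * deriv K1 x - (x ^ 2 + 1) * K1 x = 0)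
    (hK1decay : Tendsto K1 atTop (nhds 0)) (hK1pos : 0 < K1 1)
    (j1 j2 j1' j2' : ℝ)
    (hj1 : 0 < j1 ∧ J1 j1 = 0 ∧ ∀ x ∈ Set.Ioo (0:ℝ) j1, J1 x ≠ 0)
    (hj2 : j1 < j2 ∧ J1 j2 = 0 ∧ ∀ x ∈ Set.Ioo j1 j2, J1 x ≠ 0)
    (hj1' : 0 < j1' ∧ deriv J1 j1' = 0 ∧ ∀ x ∈ Set.Ioo (0:ℝ) j1', deriv J1 x ≠ 0)
    (hj2' : j1' < j2' ∧ deriv J1 j2' = 0 ∧ ∀ x ∈ Set.Ioo j1' j2', deriv J1 x ≠ 0) :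
    Real.sqrt (j1 ^ 2 - j1' ^ 2) < Real.sqrt (j2' ^ 2 - j1 ^ 2) ∧
    ∀ η ∈ Set.Icc (Real.sqrt (j1 ^ 2 - j1' ^ 2)) (Real.sqrt (j2' ^ 2 - j1 ^ 2)),
      ∃! ξ : ℝ, ξ ∈ Set.Ioo j1' j1 ∧
        J1 ξ / (ξ * deriv J1 ξ) = K1 η / (η * deriv K1 η) ∧
        j1 ^ 2 < ξ ^ 2 + η ^ 2 ∧ ξ ^ 2 + η ^ 2 < j2' ^ 2 := by
  have hJ : Differentiable ℝ J1 := hJ1smooth.differentiable (by simp)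
  have hJ' : Differentiable ℝ (deriv J1) :=
    (contDiff_infty_iff_deriv.1 hJ1smooth).2.differentiable (by simp)
  have hK : ∀ x > 0, HasDerivAt K1 (deriv K1 x) x := fun x hx =>
    ((hK1smooth.differentiableOn (by simp)).differentiableAt (Ioi_mem_nhds hx)).hasDerivAt
  have hK' : ∀ x > 0, HasDerivAt (deriv K1) (deriv (deriv K1) x) x := fun x hx =>
    ((((contDiffOn_infty_iff_deriv_of_isOpen isOpen_Ioi).1 hK1smooth).2.differentiableOn
      (by simp)).differentiableAt (Ioi_mem_nhds hx)).hasDerivAt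
  obtain ⟨hj1pos, hj1z, hj1ne⟩ := hj1
  obtain ⟨hj1'pos, hj1'z, hj1'ne⟩ := hj1'
  obtain ⟨hj12', hj2'z, hj2'ne⟩ := hj2'
  have pos := fun {x : ℝ} => besselOne_pos hJ hJ' hJ1ode hJ10 hJ1d0 (x := x)
  have dneg := fun {x : ℝ} => deriv_besselOne_neg hJ hJ' hJ1ode hJ10 hJ1d0 (x := x)
  have hj1two : 2 < j1 := by
    by_contra! h
    exact (pos hj1pos h).ne' hj1z
  have hJpos : ∀ x, 0 < x → x < j1 → 0 < J1 x := by
    intro x hx hxj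
    by_contra! h
    rcases le_or_gt x 2 with h2 | h2
    · exact (pos hx h2).not_ge h
    · obtain ⟨z, hz, hz0⟩ := intermediate_value_Icc' h2.le hJ.continuous.continuousOn
        (Set.mem_Icc.2 ⟨h, (pos two_pos le_rfl).le⟩)
      exact hj1ne z ⟨by linarith [hz.1], hz.2.trans_lt hxj⟩ hz0
  have hj1sq : j1 ^ 2 < 15 := by
    by_contra! h
    have hs : Real.sqrt 15 ^ 2 = 15 := Real.sq_sqrt (by norm_num)
    have hs0 : 0 < Real.sqrt 15 := by positivity
    have hneg := besselOne_neg hJ hJ' hJ1ode hJ10 hJ1d0 hs0 hs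
    rcases lt_or_eq_of_le (Real.sqrt_le_iff.2 ⟨hj1pos.le, h⟩) with hlt | heq
    · exact (hJpos _ hs0 hlt).not_gt hneg
    · rw [heq, hj1z] at hneg
      exact lt_irrefl _ hneg
  have hj1'sq : 3 < j1' ^ 2 := by
    by_contra! h
    exact (deriv_besselOne_pos hJ hJ' hJ1ode hJ10 hJ1d0 hj1'pos h).ne' hj1'z
  have hj1'one : 1 < j1' := by nlinarith
  have hj1'lt : j1' < j1 := by
    obtain ⟨c, hc, hc0⟩ := exists_deriv_eq_zero hj1pos hJ.continuous.continuousOn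
      (hJ10.trans hj1z.symm)
    by_contra! h
    exact hj1'ne c ⟨hc.1, hc.2.trans_le h⟩ hc0
  have hder : ∀ x, 0 < x → HasDerivAt (fun y => y * deriv J1 y) ((1 - x ^ 2) * J1 x / x) x := by
    intro x hx
    have hx' := hx.ne'
    refine ((hasDerivAt_id x).mul (hJ' x).hasDerivAt).congr_deriv ?_
    simp only [id]
    field_simp
    linarith [hJ1ode x]
  have hanti : StrictAntiOn (fun y => y * deriv J1 y) (Set.Icc 1 2) := by
    refine strictAntiOn_of_deriv_neg (convex_Icc 1 2)
      (continuous_id.mul hJ'.continuous).continuousOn ?_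
    rw [interior_Icc]
    intro x hx
    have hx0 : 0 < x := one_pos.trans hx.1
    rw [(hder x hx0).deriv]
    exact div_neg_of_neg_of_pos
      (mul_neg_of_neg_of_pos (by nlinarith [hx.1]) (pos hx0 hx.2.le)) hx0
  have hj2'sq : 27 < j2' ^ 2 := by
    by_contra! h
    have h2 : j2' < 2 := by
      by_contra! h2
      exact (dneg (by linarith) (by nlinarith) h).ne hj2'z
    have := hanti ⟨hj1'one.le, by linarith⟩ ⟨by linarith, h2.le⟩ hj12'
    simp [hj1'z, hj2'z] at this
  have hj1j2' : j1 < j2' := lt_of_pow_lt_pow_left₀ 2 (by linarith) (by linarith)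
  have hdneg : ∀ x, j1' < x → x ≤ j1 → deriv J1 x < 0 := by
    intro x hx hxj
    by_contra! h
    have hd2 := (dneg hj1pos (by nlinarith) (by linarith)).le
    obtain ⟨z, hz, hz0⟩ := intermediate_value_Icc' hxj hJ'.continuous.continuousOn
      (Set.mem_Icc.2 ⟨hd2, h⟩)
    exact hj2'ne z ⟨hx.trans_le hz.1, hz.2.trans_lt hj1j2'⟩ hz0
  have hmono : StrictMonoOn (fun x => J1 x / (x * deriv J1 x)) (Set.Ioo j1' j1) := by
    have hd : ∀ x ∈ Set.Ioo j1' j1, HasDerivAt (fun x => J1 x / (x * deriv J1 x))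
        ((deriv J1 x * (x * deriv J1 x) - J1 x * ((1 - x ^ 2) * J1 x / x)) /
          (x * deriv J1 x) ^ 2) x := fun x hx =>
      (hJ x).hasDerivAt.div (hder x (hj1'pos.trans hx.1))
        (mul_ne_zero (hj1'pos.trans hx.1).ne' (hdneg x hx.1 hx.2.le).ne)
    refine strictMonoOn_of_deriv_pos (convex_Ioo j1' j1)
      (fun x hx => (hd x hx).continuousAt.continuousWithinAt) ?_
    rw [interior_Ioo]
    intro x hx
    have hx0 : 0 < x := hj1'pos.trans hx.1
    have hdx := hdneg x hx.1 hx.2.le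
    rw [(hd x hx).deriv]
    have hdx0 := hdx.ne
    refine div_pos ?_ (by positivity)
    have h₁ : 0 < deriv J1 x * (x * deriv J1 x) := by
      nlinarith [mul_pos hx0 (mul_pos_of_neg_of_neg hdx hdx)]
    have h₂ : J1 x * ((1 - x ^ 2) * J1 x / x) ≤ 0 := by
      rw [show J1 x * ((1 - x ^ 2) * J1 x / x) = (1 - x ^ 2) * (J1 x ^ 2 / x) by ring]
      exact mul_nonpos_of_nonpos_of_nonneg (by nlinarith [hx.1]) (by positivity)
    linarith
  have hsq : j1 ^ 2 - j1' ^ 2 < j2' ^ 2 - j1 ^ 2 := by linarith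
  have hstar : 0 < j1 ^ 2 - j1' ^ 2 := by nlinarith
  refine ⟨Real.sqrt_lt_sqrt hstar.le hsq, fun η hη => ?_⟩
  have hη0 : 0 < η := (Real.sqrt_pos.2 hstar).trans_le hη.1
  have hηlow : j1 ^ 2 - j1' ^ 2 ≤ η ^ 2 := (Real.sqrt_le_left hη0.le).1 hη.1
  have hηup : η ^ 2 ≤ j2' ^ 2 - j1 ^ 2 :=
    (Real.le_sqrt hη0.le (by linarith)).1 hη.2
  have hKK := modifiedBessel_mul_deriv_neg hK hK' hK1ode hK1decay hK1pos hη0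
  have hc : K1 η / (η * deriv K1 η) < 0 := by
    have hd0 : deriv K1 η ≠ 0 := right_ne_zero_of_mul hKK.ne
    rw [show K1 η / (η * deriv K1 η) = K1 η * deriv K1 η / (η * deriv K1 η ^ 2) by field_simp]
    exact div_neg_of_neg_of_pos hKK (by positivity)
  generalize K1 η / (η * deriv K1 η) = c at hc ⊢
  have hcont : Continuous (fun x => J1 x - c * (x * deriv J1 x)) :=
    hJ.continuous.sub (continuous_const.mul (continuous_id.mul hJ'.continuous))
  obtain ⟨ξ, hξ, hξ0⟩ := intermediate_value_Ioo' hj1'lt.le hcont.continuousOn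
    (Set.mem_Ioo.2 ⟨by
      rw [hj1z, zero_sub, neg_lt_zero]
      exact mul_pos_of_neg_of_neg hc
        (mul_neg_of_pos_of_neg hj1pos (hdneg j1 hj1'lt le_rfl)), by
      rw [hj1'z, mul_zero, mul_zero, sub_zero]
      exact hJpos j1' hj1'pos hj1'lt⟩)
  have hξeq : J1 ξ / (ξ * deriv J1 ξ) = c := by
    rw [div_eq_iff (mul_ne_zero (hj1'pos.trans hξ.1).ne' (hdneg ξ hξ.1 hξ.2.le).ne)]
    exact sub_eq_zero.1 hξ0
  refine ⟨ξ, ⟨hξ, hξeq, ?_, ?_⟩, ?_⟩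
  · nlinarith [hξ.1]
  · nlinarith [hξ.1, hξ.2]
  · rintro y ⟨hy, hyeq, -, -⟩
    exact hmono.injOn hy hξ (hyeq.trans hξeq.symm)
end
end

section
/- Let J₁ be the order-one Bessel function of the first kind (so x²J₁''(x)+xJ₁'(x)=(1-x²)J₁(x), J₁(0)=0, J₁'(0)=1/2), with positive zeros j₁<j₂<… of J₁ and j₁'<j₂'<… of J₁'. Then x²(J₁'(x))² > (1-x²)J₁(x)² for all x ∈ (0,∞); indeed x²(J₁'(x))² = (1-x²)J₁(x)² + ∫₀ˣ 2sJ₁(s)²ds. Consequently the function α(x) = J₁(x)/(xJ₁'(x)) satisfies lim_{x→0⁺}α(x)=1 and is strictly increasing on (0, j₁') and on each interval (j_k', j_{k+1}'), k = 1,2,3,…. -/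
open MeasureTheory Filter Matrix
open scoped Classical

noncomputable section

set_option linter.unusedVariables false


/-- Bessel's equation of order one makes `x² y'² - (1 - x²) y²` an antiderivative of `2 x y²`. -/
lemma hasDerivAt_besselOne_energy {y : ℝ → ℝ} (hy : Differentiable ℝ y)
    (hy' : Differentiable ℝ (deriv y))
    (hode : ∀ x : ℝ, x ^ 2 * deriv (deriv y) x + x * deriv y x + (x ^ 2 - 1) * y x = 0) (x : ℝ) :
    HasDerivAt (fun x => x ^ 2 * deriv y x ^ 2 - (1 - x ^ 2) * y x ^ 2) (2 * x * y x ^ 2) x := by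
  have h1 := (hy x).hasDerivAt
  have h2 := (hy' x).hasDerivAt
  have h3 := hasDerivAt_pow 2 x
  refine ((h3.mul (h2.pow 2)).sub ((h3.const_sub 1).mul (h1.pow 2))).congr_deriv ?_
  simp only [Pi.pow_apply]
  push_cast
  linear_combination 2 * deriv y x * hode x

/-- If `y` vanishes at the origin with nonzero slope, then `y x / (x y' x) → 1` as `x → 0⁺`. -/
lemma tendsto_div_mul_deriv_nhdsGT_zero {y : ℝ → ℝ} (hy : DifferentiableAt ℝ y 0)
    (hy' : ContinuousAt (deriv y) 0) (h0 : y 0 = 0) (hd0 : deriv y 0 ≠ 0) :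
    Tendsto (fun x => y x / (x * deriv y x)) (nhdsWithin 0 (Set.Ioi 0)) (nhds 1) := by
  have hs : Tendsto (fun x => x⁻¹ * y x) (nhdsWithin 0 (Set.Ioi 0)) (nhds (deriv y 0)) := by
    simpa [h0] using hy.hasDerivAt.tendsto_slope_zero_right
  have h := hs.div (hy'.tendsto.mono_left nhdsWithin_le_nhds) hd0
  rw [div_self hd0] at h
  refine h.congr fun x => ?_
  simp only [Pi.div_apply, div_eq_mul_inv, mul_inv]
  ring

/-- A function with positive slope at a zero at the origin is positive somewhere in `(0, x)`. -/
lemma exists_mem_Ioo_pos_of_deriv_pos {y : ℝ → ℝ} (hy : DifferentiableAt ℝ y 0) (h0 : y 0 = 0)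
    (hd0 : 0 < deriv y 0) {x : ℝ} (hx : 0 < x) : ∃ c ∈ Set.Ioo 0 x, 0 < y c := by
  have hs : Tendsto (fun x => x⁻¹ * y x) (nhdsWithin 0 (Set.Ioi 0)) (nhds (deriv y 0)) := by
    simpa [h0] using hy.hasDerivAt.tendsto_slope_zero_right
  obtain ⟨c, hc, hcx⟩ := ((hs.eventually_const_lt hd0).and (Ioo_mem_nhdsGT hx)).exists
  exact ⟨c, hcx, (pos_iff_pos_of_mul_pos hc).1 (inv_pos.2 hcx.1)⟩

/-- For a solution `y` of Bessel's equation of order one with positive energy,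
`y x / (x y' x)` is strictly increasing on intervals of `(0, ∞)` free of zeros of `y'`. -/
lemma strictMonoOn_besselOne_div_mul_deriv {y : ℝ → ℝ} (hy : Differentiable ℝ y)
    (hy' : Differentiable ℝ (deriv y))
    (hode : ∀ x : ℝ, x ^ 2 * deriv (deriv y) x + x * deriv y x + (x ^ 2 - 1) * y x = 0)
    (hpos : ∀ x > (0 : ℝ), (1 - x ^ 2) * y x ^ 2 < x ^ 2 * deriv y x ^ 2)
    {a b : ℝ} (ha : 0 ≤ a) (hne : ∀ x ∈ Set.Ioo a b, deriv y x ≠ 0) :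
    StrictMonoOn (fun x => y x / (x * deriv y x)) (Set.Ioo a b) := by
  have hderiv : ∀ x ∈ Set.Ioo a b, HasDerivAt (fun x => y x / (x * deriv y x))
      ((deriv y x * (x * deriv y x) - y x * (1 * deriv y x + x * deriv (deriv y) x))
        / (x * deriv y x) ^ 2) x := fun x hx =>
    (hy x).hasDerivAt.div ((hasDerivAt_id x).mul (hy' x).hasDerivAt)
      (mul_ne_zero (ha.trans_lt hx.1).ne' (hne x hx))
  refine strictMonoOn_of_deriv_pos (convex_Ioo a b)
    (fun x hx => (hderiv x hx).continuousAt.continuousWithinAt) fun x hx => ?_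
  rw [interior_Ioo] at hx
  have hx0 : 0 < x := ha.trans_lt hx.1
  have hden : x * deriv y x ≠ 0 := mul_ne_zero hx0.ne' (hne x hx)
  rw [(hderiv x hx).deriv]
  refine div_pos (pos_of_mul_pos_right (a := x) ?_ hx0.le) (by positivity)
  linear_combination hpos x hx0 + y x * hode x

/-- Appendix Lemma, part on `J₁`.  Let `J₁` be the order-one
Bessel function of the first kind (smooth solution of
`x²J₁'' + xJ₁' = (1-x²)J₁` with `J₁(0) = 0`, `J₁'(0) = 1/2`), with positive zeros
`j'_1 < j'_2 < …` of `J₁'`.  Then `x²(J₁'(x))² = (1-x²)J₁(x)² + ∫₀ˣ 2s J₁(s)² ds`,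
hence `x²(J₁'(x))² > (1-x²)J₁(x)²` for all `x > 0`; consequently
`α(x) = J₁(x)/(x J₁'(x))` satisfies `α(x) → 1` as `x → 0⁺` and is strictly
increasing on `(0, j'_1)` and on each interval `(j'_k, j'_{k+1})`. -/
theorem statement18 (J1 : ℝ → ℝ)
    (hsmooth : ContDiff ℝ (⊤ : ℕ∞) J1)
    (hode : ∀ x : ℝ,
      x ^ 2 * deriv (deriv J1) x + x * deriv J1 x + (x ^ 2 - 1) * J1 x = 0)
    (h0 : J1 0 = 0) (hd0 : deriv J1 0 = 1 / 2)
    (j' : ℕ → ℝ) (hmono : StrictMono j') (hpos : ∀ k, 0 < j' k)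
    (hzero : ∀ k, deriv J1 (j' k) = 0)
    (hall : ∀ x > (0:ℝ), deriv J1 x = 0 → ∃ k, j' k = x) :
    (∀ x > (0:ℝ), x ^ 2 * (deriv J1 x) ^ 2
        = (1 - x ^ 2) * (J1 x) ^ 2 + ∫ s in (0:ℝ)..x, 2 * s * (J1 s) ^ 2) ∧
    (∀ x > (0:ℝ), (1 - x ^ 2) * (J1 x) ^ 2 < x ^ 2 * (deriv J1 x) ^ 2) ∧
    Tendsto (fun x => J1 x / (x * deriv J1 x)) (nhdsWithin 0 (Set.Ioi 0)) (nhds 1) ∧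
    StrictMonoOn (fun x => J1 x / (x * deriv J1 x)) (Set.Ioo 0 (j' 0)) ∧
    ∀ k : ℕ, StrictMonoOn (fun x => J1 x / (x * deriv J1 x))
      (Set.Ioo (j' k) (j' (k + 1))) := by
  have hy : Differentiable ℝ J1 := hsmooth.differentiable (by simp)
  have hy' : Differentiable ℝ (deriv J1) :=
    ((contDiff_infty_iff_deriv.1 hsmooth).2).differentiable (by simp)
  have hcont : Continuous fun s => 2 * s * J1 s ^ 2 := by
    have := hy.continuous
    fun_prop
  have henergy : ∀ x > (0:ℝ), x ^ 2 * (deriv J1 x) ^ 2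
      = (1 - x ^ 2) * (J1 x) ^ 2 + ∫ s in (0:ℝ)..x, 2 * s * (J1 s) ^ 2 := fun x _ => by
    rw [intervalIntegral.integral_eq_sub_of_hasDerivAt
      (fun s _ => hasDerivAt_besselOne_energy hy hy' hode s) (hcont.intervalIntegrable 0 x), h0]
    ring
  have hlt : ∀ x > (0:ℝ), (1 - x ^ 2) * (J1 x) ^ 2 < x ^ 2 * (deriv J1 x) ^ 2 := fun x hx => by
    obtain ⟨c, hc, hyc⟩ := exists_mem_Ioo_pos_of_deriv_pos (hy 0) h0 (by norm_num [hd0]) hx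
    have hc0 := hc.1
    rw [henergy x hx]
    exact lt_add_of_pos_right _ (intervalIntegral.integral_pos hx hcont.continuousOn
      (fun s hs => mul_nonneg (mul_nonneg zero_le_two hs.1.le) (sq_nonneg _))
      ⟨c, Set.Ioo_subset_Icc_self hc, by positivity⟩)
  refine ⟨henergy, hlt, tendsto_div_mul_deriv_nhdsGT_zero (hy 0) (hy' 0).continuousAt h0
    (by norm_num [hd0]), ?_, fun k => ?_⟩
  · refine strictMonoOn_besselOne_div_mul_deriv hy hy' hode hlt le_rfl fun x hx hx' => ?_
    obtain ⟨m, rfl⟩ := hall x hx.1 hx'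
    exact (hmono.lt_iff_lt.1 hx.2).not_ge m.zero_le
  · refine strictMonoOn_besselOne_div_mul_deriv hy hy' hode hlt (hpos k).le fun x hx hx' => ?_
    obtain ⟨m, rfl⟩ := hall x ((hpos k).trans hx.1) hx'
    have h1 := hmono.lt_iff_lt.1 hx.1
    have h2 := hmono.lt_iff_lt.1 hx.2
    omega
end
end

section
/- Let K₁ be the order-one modified Bessel function of the second kind (so x²K₁''(x)+xK₁'(x)=(1+x²)K₁(x), with K₁, K₁', K₁'' decaying exponentially at infinity, xK₀(x)→0 and K₁(x)→∞ as x→0⁺, and xK₁'(x)+K₁(x)=-xK₀(x)). Then x²(K₁'(x))² > (1+x²)K₁(x)² for all x ∈ (0,∞); indeed x²(K₁'(x))² = (1+x²)K₁(x)² + ∫ₓ^∞ 2sK₁(s)²ds. Consequently the function β(x) = K₁(x)/(xK₁'(x)) satisfies lim_{x→0⁺}β(x) = -1 and is negative and strictly increasing on (0,∞). -/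
open MeasureTheory Filter Matrix
open scoped Classical

noncomputable section

set_option linter.unusedVariables false


/-- On `(0, y]`, a solution of the modified Bessel equation of order one that vanishes at `y`
together with its derivative is zero. -/
theorem eq_zero_of_modifiedBessel {f g : ℝ → ℝ}
    (hf : ∀ x > (0:ℝ), HasDerivAt f (deriv f x) x)
    (hg : ∀ x > (0:ℝ), HasDerivAt (deriv f) (g x) x)
    (hode : ∀ x > (0:ℝ), x ^ 2 * g x + x * deriv f x = (1 + x ^ 2) * f x)
    {y : ℝ} (hy : 0 < y) (h0 : f y = 0) (h1 : deriv f y = 0) {x : ℝ} (hx : 0 < x) (hxy : x ≤ y) :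
    f x = 0 := by
  obtain ⟨n, hn⟩ := exists_nat_ge (2 + y ^ 2)
  let E : ℝ → ℝ := fun t => t ^ (n + 1) * ((f t) ^ 2 + (t * deriv f t) ^ 2)
  have hE : ∀ t > (0:ℝ), HasDerivAt E
      (t ^ n * ((n + 1) * ((f t) ^ 2 + (t * deriv f t) ^ 2)
        + 2 * (2 + t ^ 2) * (f t * (t * deriv f t)))) t := by
    intro t ht
    have h := (hasDerivAt_pow (n + 1) t).mul
      (((hf t ht).pow 2).add (((hasDerivAt_id t).mul (hg t ht)).pow 2))
    refine h.congr_deriv ?_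
    have := hode t ht
    simp only [Pi.mul_apply, Pi.pow_apply, Pi.add_apply, id, Nat.add_sub_cancel]
    push_cast
    linear_combination (2 * t ^ n * (t * deriv f t)) * this
  have hmono : MonotoneOn E (Set.Icc x y) := by
    refine monotoneOn_of_deriv_nonneg (convex_Icc x y)
      (fun t ht => (hE t (hx.trans_le ht.1)).continuousAt.continuousWithinAt) ?_ ?_
    · intro t ht
      rw [interior_Icc] at ht
      exact (hE t (hx.trans ht.1)).differentiableAt.differentiableWithinAt
    · intro t ht
      rw [interior_Icc] at ht
      have ht0 := hx.trans ht.1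
      rw [(hE t ht0).deriv]
      have hty : t ^ 2 ≤ y ^ 2 := pow_le_pow_left₀ ht0.le ht.2.le 2
      refine mul_nonneg (pow_nonneg ht0.le n) ?_
      generalize f t = u
      generalize t * deriv f t = v
      nlinarith [mul_nonneg (by positivity : 0 ≤ 2 + t ^ 2) (sq_nonneg (u + v)),
        mul_nonneg (by linarith : 0 ≤ (n : ℝ) + 1 - (2 + t ^ 2))
          (by positivity : 0 ≤ u ^ 2 + v ^ 2)]
  have h := hmono ⟨le_rfl, hxy⟩ ⟨hxy, le_rfl⟩ hxy
  simp only [E, h0, h1] at h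
  have hpos : 0 < x ^ (n + 1) := pow_pos hx _
  have : (f x) ^ 2 + (x * deriv f x) ^ 2 ≤ 0 := by
    by_contra! hc
    have := mul_pos hpos hc
    norm_num at h
    linarith
  nlinarith [sq_nonneg (f x), sq_nonneg (x * deriv f x)]

/-- Appendix Lemma, part on `K₁`.  Let `K₀, K₁` be the modified
Bessel functions of the second kind of orders zero and one: `K₁` solves
`x²K₁'' + xK₁' = (1+x²)K₁` on `(0,∞)`, satisfies `xK₁'(x) + K₁(x) = -xK₀(x)`,
`xK₀(x) → 0` and `K₁(x) → ∞` as `x → 0⁺`, and `K₁, K₁', K₁''` decay exponentially at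
infinity.  Then `x²(K₁'(x))² = (1+x²)K₁(x)² + ∫ₓ^∞ 2s K₁(s)² ds`, hence
`x²(K₁'(x))² > (1+x²)K₁(x)²` for `x > 0`; consequently `β(x) = K₁(x)/(x K₁'(x))`
satisfies `β(x) → -1` as `x → 0⁺` and is negative and strictly increasing on
`(0,∞)`. -/
theorem statement19 (K0 K1 : ℝ → ℝ)
    (hK1smooth : ContDiffOn ℝ (⊤ : ℕ∞) K1 (Set.Ioi 0))
    (hode : ∀ x > (0:ℝ),
      x ^ 2 * deriv (deriv K1) x + x * deriv K1 x = (1 + x ^ 2) * K1 x)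
    (hrel : ∀ x > (0:ℝ), x * deriv K1 x + K1 x = -x * K0 x)
    (hK0asym : Tendsto (fun x => x * K0 x) (nhdsWithin 0 (Set.Ioi 0)) (nhds 0))
    (hK1asym : Tendsto K1 (nhdsWithin 0 (Set.Ioi 0)) atTop)
    (hdecay : ∃ a > (0:ℝ), ∃ C : ℝ, ∀ x ≥ (1:ℝ),
      |K1 x| + |deriv K1 x| + |deriv (deriv K1) x| ≤ C * Real.exp (-a * x)) :
    (∀ x > (0:ℝ),
      IntegrableOn (fun s => 2 * s * (K1 s) ^ 2) (Set.Ioi x) volume ∧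
      x ^ 2 * (deriv K1 x) ^ 2
        = (1 + x ^ 2) * (K1 x) ^ 2 + ∫ s in Set.Ioi x, 2 * s * (K1 s) ^ 2) ∧
    (∀ x > (0:ℝ), (1 + x ^ 2) * (K1 x) ^ 2 < x ^ 2 * (deriv K1 x) ^ 2) ∧
    Tendsto (fun x => K1 x / (x * deriv K1 x)) (nhdsWithin 0 (Set.Ioi 0)) (nhds (-1)) ∧
    (∀ x > (0:ℝ), K1 x / (x * deriv K1 x) < 0) ∧
    StrictMonoOn (fun x => K1 x / (x * deriv K1 x)) (Set.Ioi 0) := by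
  have hK : ∀ x > (0:ℝ), HasDerivAt K1 (deriv K1 x) x := fun x hx =>
    ((hK1smooth.differentiableOn (by simp)).differentiableAt (Ioi_mem_nhds hx)).hasDerivAt
  have hK' : ∀ x > (0:ℝ), HasDerivAt (deriv K1) (deriv (deriv K1) x) x := by
    intro x hx
    have h : ContDiffOn ℝ 1 (deriv K1) (Set.Ioi 0) :=
      hK1smooth.deriv_of_isOpen isOpen_Ioi (by norm_cast)
    exact ((h.differentiableOn (by simp)).differentiableAt (Ioi_mem_nhds hx)).hasDerivAt
  obtain ⟨a, ha, C, hC⟩ := hdecay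
  have hexp : ∀ n : ℕ, Tendsto (fun x : ℝ => C * (x ^ n * Real.exp (-a * x))) atTop (nhds 0) := by
    intro n
    have := (tendsto_rpow_mul_exp_neg_mul_atTop_nhds_zero n a ha).const_mul C
    simpa using this
  have hlim : ∀ (n : ℕ) (f : ℝ → ℝ), (∀ x ≥ (1:ℝ), |f x| ≤ C * Real.exp (-a * x)) →
      Tendsto (fun x => x ^ n * f x) atTop (nhds 0) := by
    intro n f hf
    refine squeeze_zero_norm' ?_ (hexp n)
    filter_upwards [eventually_ge_atTop 1] with x hx
    have hxn : 0 ≤ x ^ n := by positivity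
    rw [Real.norm_eq_abs, abs_mul, abs_of_nonneg hxn, mul_left_comm]
    exact mul_le_mul_of_nonneg_left (hf x hx) hxn
  have hb0 : ∀ x ≥ (1:ℝ), |K1 x| ≤ C * Real.exp (-a * x) := fun x hx => by
    linarith [hC x hx, abs_nonneg (deriv K1 x), abs_nonneg (deriv (deriv K1) x)]
  have hb1 : ∀ x ≥ (1:ℝ), |deriv K1 x| ≤ C * Real.exp (-a * x) := fun x hx => by
    linarith [hC x hx, abs_nonneg (K1 x), abs_nonneg (deriv (deriv K1) x)]
  have hK0lim : Tendsto K1 atTop (nhds 0) := by simpa using hlim 0 K1 hb0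
  let G : ℝ → ℝ := fun x => x ^ 2 * (deriv K1 x) ^ 2 - (1 + x ^ 2) * (K1 x) ^ 2
  have hGlim : Tendsto G atTop (nhds 0) := by
    have h := (((hlim 1 _ hb1).pow 2).sub ((hlim 0 _ hb0).pow 2)).sub ((hlim 1 _ hb0).pow 2)
    norm_num at h
    refine h.congr fun x => ?_
    simp only [G]
    ring
  have hG : ∀ x > (0:ℝ), HasDerivAt G (-(2 * x * (K1 x) ^ 2)) x := by
    intro x hx
    have h := ((hasDerivAt_pow 2 x).mul ((hK' x hx).pow 2)).sub
      (((hasDerivAt_pow 2 x).const_add 1).mul ((hK x hx).pow 2))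
    refine h.congr_deriv ?_
    have := hode x hx
    simp only [Pi.pow_apply]
    push_cast
    linear_combination (2 * deriv K1 x) * this
  have hGneg : ∀ x > (0:ℝ), ∀ y ∈ Set.Ioi x, -(2 * y * (K1 y) ^ 2) ≤ 0 := by
    intro x hx y hy
    have : 0 < y := hx.trans hy
    simp only [Left.neg_nonpos_iff]
    positivity
  have hK1int : ∀ x > (0:ℝ), IntegrableOn (fun s => 2 * s * (K1 s) ^ 2) (Set.Ioi x) volume := by
    intro x hx
    have := integrableOn_Ioi_deriv_of_nonpos' (fun y hy => hG y (hx.trans_le hy)) (hGneg x hx) hGlim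
    simpa using this.neg
  have hGint : ∀ x > (0:ℝ), G x = ∫ s in Set.Ioi x, 2 * s * (K1 s) ^ 2 := by
    intro x hx
    have := integral_Ioi_of_hasDerivAt_of_nonpos' (fun y hy => hG y (hx.trans_le hy))
      (hGneg x hx) hGlim
    rw [integral_neg] at this
    linarith
  have hGnonneg : ∀ x > (0:ℝ), 0 ≤ G x := by
    intro x hx
    rw [hGint x hx]
    refine setIntegral_nonneg measurableSet_Ioi fun y hy => ?_
    have : 0 < y := hx.trans hy
    positivity
  have hGanti : AntitoneOn G (Set.Ioi 0) := by
    refine antitoneOn_of_deriv_nonpos (convex_Ioi 0)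
      (fun t ht => (hG t ht).continuousAt.continuousWithinAt) ?_ ?_
    · rw [interior_Ioi]
      exact fun t ht => (hG t ht).differentiableAt.differentiableWithinAt
    · rw [interior_Ioi]
      intro t ht
      rw [(hG t ht).deriv]
      exact hGneg (t / 2) (half_pos ht) t (Set.mem_Ioi.2 (half_lt_self ht))
  have hGpos : ∀ x > (0:ℝ), 0 < G x := by
    intro x hx
    by_contra! hGx
    have hzero : ∀ t ≥ x, G t = 0 := fun t ht =>
      le_antisymm ((hGanti hx (hx.trans_le ht) ht).trans hGx) (hGnonneg t (hx.trans_le ht))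
    have hy : 0 < x + 1 := by linarith
    have hloc : G =ᶠ[nhds (x + 1)] fun _ => 0 := by
      filter_upwards [Ioi_mem_nhds (show x < x + 1 by linarith)] with t ht
      exact hzero t (le_of_lt ht)
    have hd := (hG _ hy).unique ((hasDerivAt_const (x + 1) (0:ℝ)).congr_of_eventuallyEq hloc)
    have hKy : K1 (x + 1) = 0 := by simpa [hy.ne'] using hd
    have hKy' : deriv K1 (x + 1) = 0 := by
      simpa [G, hKy, hy.ne'] using hzero (x + 1) (by linarith)
    have hev : ∀ᶠ t in nhdsWithin (0:ℝ) (Set.Ioi 0), t ∈ Set.Ioo 0 (x + 1) :=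
      Ioo_mem_nhdsGT hy
    obtain ⟨t, ht, htK⟩ := (hev.and (hK1asym.eventually_gt_atTop 0)).exists
    exact htK.ne' (eq_zero_of_modifiedBessel hK hK' hode hy hKy hKy' ht.1 ht.2.le)
  have hineq : ∀ x > (0:ℝ), (1 + x ^ 2) * (K1 x) ^ 2 < x ^ 2 * (deriv K1 x) ^ 2 :=
    fun x hx => sub_pos.1 (hGpos x hx)
  have hne : ∀ x ∈ Set.Ioi (0:ℝ), deriv K1 x ≠ 0 := by
    intro x hx h
    have := hineq x hx
    rw [h] at this
    nlinarith [mul_nonneg (by positivity : 0 ≤ 1 + x ^ 2) (sq_nonneg (K1 x))]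
  have hcont : ContinuousOn K1 (Set.Ioi 0) :=
    fun t ht => (hK t ht).continuousAt.continuousWithinAt
  have hneg : ∀ x > (0:ℝ), deriv K1 x < 0 := by
    rcases hasDerivWithinAt_forall_lt_or_forall_gt_of_forall_ne (convex_Ioi (0:ℝ))
      (fun x hx => (hK x hx).hasDerivWithinAt) hne with h | h
    · exact h
    · exfalso
      have hmono : StrictMonoOn K1 (Set.Ioi 0) := by
        refine strictMonoOn_of_deriv_pos (convex_Ioi 0) hcont ?_
        rw [interior_Ioi]
        exact h
      have hev : ∀ᶠ t in nhdsWithin (0:ℝ) (Set.Ioi 0), t ∈ Set.Ioo 0 (1:ℝ) :=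
        Ioo_mem_nhdsGT one_pos
      obtain ⟨t, ht, htK⟩ := (hev.and (hK1asym.eventually_gt_atTop (K1 1))).exists
      exact lt_asymm htK (hmono ht.1 (Set.mem_Ioi.2 one_pos) ht.2)
  have hanti : StrictAntiOn K1 (Set.Ioi 0) := by
    refine strictAntiOn_of_deriv_neg (convex_Ioi 0) hcont ?_
    rw [interior_Ioi]
    exact hneg
  have hpos : ∀ x > (0:ℝ), 0 < K1 x := by
    intro x hx
    have hx1 : 0 < x + 1 := by linarith
    have hle : 0 ≤ K1 (x + 1) := by
      refine le_of_tendsto hK0lim ?_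
      filter_upwards [eventually_ge_atTop (x + 1)] with t ht
      exact hanti.antitoneOn hx1 (hx1.trans_le ht) ht
    exact hle.trans_lt (hanti hx hx1 (by linarith))
  refine ⟨fun x hx => ⟨hK1int x hx, ?_⟩, hineq, ?_, ?_, ?_⟩
  · rw [← hGint x hx]
    simp only [G]
    ring
  · have h : Tendsto (fun x => (-1 - x * K0 x * (K1 x)⁻¹)⁻¹) (nhdsWithin 0 (Set.Ioi 0))
        (nhds (-1)) := by
      have := (hK0asym.mul hK1asym.inv_tendsto_atTop).const_sub (-1)
      simpa using this.inv₀ (by norm_num)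
    refine h.congr' ?_
    filter_upwards [self_mem_nhdsWithin] with x hx
    have h1 : x * deriv K1 x = K1 x * (-1 - x * K0 x * (K1 x)⁻¹) := by
      have := hrel x hx
      have := (hpos x hx).ne'
      field_simp
      linarith
    rw [h1, div_mul_eq_div_div, div_self (hpos x hx).ne', one_div]
  · exact fun x hx => div_neg_of_pos_of_neg (hpos x hx) (mul_neg_of_pos_of_neg hx (hneg x hx))
  · have hβ : ∀ x > (0:ℝ), HasDerivAt (fun x => K1 x / (x * deriv K1 x))
        (G x / (x * (x * deriv K1 x) ^ 2)) x := by
      intro x hx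
      have hd := hne x hx
      have hx' : x ≠ 0 := ne_of_gt hx
      refine ((hK x hx).div ((hasDerivAt_id x).mul (hK' x hx)) (mul_ne_zero hx' hd)).congr_deriv ?_
      simp only [Pi.mul_apply, id, G]
      rw [div_eq_div_iff (by positivity) (by positivity)]
      linear_combination (-(K1 x) * (x * deriv K1 x) ^ 2) * hode x hx
    refine strictMonoOn_of_deriv_pos (convex_Ioi 0)
      (fun t ht => (hβ t ht).continuousAt.continuousWithinAt) ?_
    rw [interior_Ioi]
    intro x hx
    rw [(hβ x hx).deriv]
    have := hne x hx
    have : 0 < x := hx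
    have := hGpos x hx
    positivity
end
end
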